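/- For every λ > 0 there exists δ > 0 (one may take δ = 1/(1+2λ)) such that for every convex set X ⊆ ℝ^d with diam(X) ≤ λ · inr(X), every 0 < r ≤ diam(X), and every x ∈ X, there exists z such that the open ball B(z, δr) is contained in B(x,r) ∩ X. -/

import Mathlib

open Metric

/-- The inradius of a set `X ⊆ ℝ^d`: the supremum of radii of open balls contained in `X`. -/
noncomputable def inr {d : ℕ} (X : Set (EuclideanSpace ℝ (Fin d))) : ℝ :=
  sSup {s : ℝ | ∃ p, ball p s ⊆ X}

theorem stmt_5 (d : ℕ) (lam : ℝ) (hlam : 0 < lam) :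
    ∃ δ > (0 : ℝ), ∀ X : Set (EuclideanSpace ℝ (Fin d)), Convex ℝ X →
      Metric.diam X ≤ lam * inr X →
      ∀ r : ℝ, 0 < r → r ≤ Metric.diam X →
      ∀ x ∈ X, ∃ z, ball z (δ * r) ⊆ ball x r ∩ X := by
  refine ⟨min (1 / 2) (1 / (4 * lam)), by positivity, ?_⟩
  intro X hX hd r hr hrD x hx
  set δ := min (1 / 2) (1 / (4 * lam)) with hδ
  have hδ1 : δ ≤ 1 / 2 := min_le_left _ _
  have hδ2 : δ ≤ 1 / (4 * lam) := min_le_right _ _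
  set D := Metric.diam X with hDdef
  have hD : 0 < D := lt_of_lt_of_le hr hrD
  have hb : Bornology.IsBounded X := by
    by_contra h
    exact hD.ne' (Metric.diam_eq_zero_of_unbounded h)
  have hinr : 0 < inr X := by
    by_contra h
    have h' : inr X ≤ 0 := not_lt.mp h
    nlinarith
  have hne : {s : ℝ | ∃ p, ball p s ⊆ X}.Nonempty :=
    ⟨0, x, by simp⟩
  have hlt : D / (2 * lam) < sSup {s : ℝ | ∃ p, ball p s ⊆ X} := by
    change D / (2 * lam) < inr X
    rw [div_lt_iff₀ (by positivity)]
    nlinarith [mul_pos hlam hinr]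
  obtain ⟨s, ⟨p, hp⟩, hs⟩ := exists_lt_of_lt_csSup hne hlt
  have hs0 : 0 < s := lt_trans (by positivity) hs
  have hpX : p ∈ X := hp (mem_ball_self hs0)
  have hdist : ‖p - x‖ ≤ D := by
    rw [← dist_eq_norm]
    exact Metric.dist_le_diam_of_mem hb hpX hx
  obtain ⟨t, ht⟩ : ∃ t, t = r / (2 * D) := ⟨_, rfl⟩
  have ht0 : 0 < t := by rw [ht]; positivity
  have htD : t * D = r / 2 := by rw [ht]; field_simp
  have ht1 : t ≤ 1 := by
    by_contra h
    nlinarith [not_le.mp h]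
  have hts : δ * r ≤ t * s := by
    calc δ * r ≤ 1 / (4 * lam) * r := by gcongr
      _ = t * (D / (2 * lam)) := by
        rw [ht]; field_simp; norm_num
      _ ≤ t * s := by gcongr
  refine ⟨x + t • (p - x), fun y hy => ⟨?_, ?_⟩⟩
  · rw [mem_ball] at hy ⊢
    have h1 : dist (x + t • (p - x)) x ≤ r / 2 := by
      rw [dist_eq_norm, add_sub_cancel_left, norm_smul, Real.norm_of_nonneg ht0.le, ← htD]
      gcongr
    have h2 : δ * r ≤ r / 2 := by nlinarith
    linarith [dist_triangle y (x + t • (p - x)) x]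
  · rw [mem_ball, dist_eq_norm] at hy
    have hq : p + t⁻¹ • (y - (x + t • (p - x))) ∈ X := by
      apply hp
      rw [mem_ball, dist_eq_norm, add_sub_cancel_left, norm_smul, norm_inv,
        Real.norm_of_nonneg ht0.le, inv_mul_lt_iff₀ ht0]
      linarith
    have := hX.add_smul_sub_mem hx hq ⟨ht0.le, ht1⟩
    convert this using 1
    have e : t • t⁻¹ • (y - (x + t • (p - x))) = y - (x + t • (p - x)) :=
      smul_inv_smul₀ ht0.ne' _
    rw [add_sub_right_comm, smul_add, e]
    abel
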